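/- arXiv:1907.10154 — 5 statements merged into one kernel-verified Lean document; each statement's English description precedes it below -/
import Mathlib

section
/- For every γ > 0, P(S_n ≥ γ + n·δ_n·R̄ | E_n) ≤ exp(−γ² / (8 ∑_{i=1}^n d_i²)). -/
open MeasureTheory ProbabilityTheory

theorem Real.exp_mul_le_cosh_add_div_mul_sinh {x e : ℝ} (hx : |x| ≤ e) (t : ℝ) :
    Real.exp (t * x) ≤ Real.cosh (t * e) + x / e * Real.sinh (t * e) := by
  rcases ((abs_nonneg x).trans hx).eq_or_lt with he | he
  · obtain rfl : x = 0 := abs_nonpos_iff.1 (he ▸ hx)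
    simp [← he]
  · have h := Real.exp_mul_le_cosh_add_mul_sinh (t := x / e)
      (by rw [abs_div, abs_of_pos he]; exact (div_le_one he).2 hx) (t * e)
    rwa [show x / e * (t * e) = t * x by field_simp] at h

theorem integral_mul_eq_zero_of_condExp_eq_zero {Ω : Type*} {m mΩ : MeasurableSpace Ω}
    {P : Measure Ω} [IsFiniteMeasure P] (hm : m ≤ mΩ) {g X : Ω → ℝ} (hg : Measurable[m] g)
    {C : ℝ} (hgC : ∀ᵐ ω ∂P, |g ω| ≤ C) (hX : Integrable X P) (hX0 : P[X | m] =ᵐ[P] 0) :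
    ∫ ω, g ω * X ω ∂P = 0 := by
  have h := condExp_stronglyMeasurable_mul_of_bound hm hg.stronglyMeasurable hX C hgC
  have h' : P[g * X | m] =ᵐ[P] 0 := by
    filter_upwards [h, hX0] with ω h1 h2
    simp [h1, h2]
  calc ∫ ω, g ω * X ω ∂P = ∫ ω, (P[g * X | m]) ω ∂P := (integral_condExp hm).symm
    _ = 0 := by rw [integral_congr_ae h']; simp

theorem ae_abs_sum_range_le {Ω : Type*} {mΩ : MeasurableSpace Ω} {P : Measure Ω}
    {n : ℕ} {X : ℕ → Ω → ℝ} {e : ℕ → ℝ} (hXe : ∀ i < n, ∀ᵐ ω ∂P, |X i ω| ≤ e i) :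
    ∀ᵐ ω ∂P, |∑ i ∈ Finset.range n, X i ω| ≤ ∑ i ∈ Finset.range n, e i := by
  have h : ∀ᵐ ω ∂P, ∀ i ∈ Finset.range n, |X i ω| ≤ e i :=
    (Finset.eventually_all _).2 fun i hi => hXe i (Finset.mem_range.1 hi)
  filter_upwards [h] with ω hω
  exact (Finset.abs_sum_le_sum_abs _ _).trans (Finset.sum_le_sum hω)

theorem measurable_sum_range_of_adapted {Ω : Type*} {mΩ : MeasurableSpace Ω}
    (ℱ : Filtration ℕ mΩ) {X : ℕ → Ω → ℝ} (hX : ∀ i, Measurable[ℱ (i + 1)] (X i)) (n : ℕ) :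
    Measurable[ℱ n] fun ω => ∑ i ∈ Finset.range n, X i ω :=
  Finset.measurable_fun_sum _ fun i hi =>
    (hX i).mono (ℱ.mono (Finset.mem_range.1 hi)) le_rfl

theorem integrable_exp_mul_of_ae_abs_le {Ω : Type*} {mΩ : MeasurableSpace Ω} {P : Measure Ω}
    [IsFiniteMeasure P] {T : Ω → ℝ} (hT : Measurable T) {D : ℝ} (hTD : ∀ᵐ ω ∂P, |T ω| ≤ D)
    (t : ℝ) : Integrable (fun ω => Real.exp (t * T ω)) P := by
  refine Integrable.of_bound (by fun_prop) (Real.exp (|t| * D)) ?_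
  filter_upwards [hTD] with ω hω
  rw [Real.norm_eq_abs, Real.abs_exp, Real.exp_le_exp]
  calc t * T ω ≤ |t * T ω| := le_abs_self _
    _ = |t| * |T ω| := abs_mul _ _
    _ ≤ |t| * D := by gcongr

/-- Exponential moment bound of Azuma and Hoeffding. -/
theorem integral_exp_mul_sum_le {Ω : Type*} {mΩ : MeasurableSpace Ω} {P : Measure Ω}
    [IsProbabilityMeasure P] (ℱ : Filtration ℕ mΩ) {X : ℕ → Ω → ℝ} {e : ℕ → ℝ}
    (hX : ∀ i, Measurable[ℱ (i + 1)] (X i)) (t : ℝ) (n : ℕ)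
    (hXe : ∀ i < n, ∀ᵐ ω ∂P, |X i ω| ≤ e i) (hX0 : ∀ i < n, P[X i | ℱ i] =ᵐ[P] 0) :
    ∫ ω, Real.exp (t * ∑ i ∈ Finset.range n, X i ω) ∂P ≤
      Real.exp ((∑ i ∈ Finset.range n, e i ^ 2) * t ^ 2 / 2) := by
  induction n with
  | zero => simp
  | succ n ih =>
    have hXe' : ∀ i < n, ∀ᵐ ω ∂P, |X i ω| ≤ e i := fun i hi => hXe i (by omega)
    specialize ih hXe' fun i hi => hX0 i (by omega)
    have hXn : Measurable (X n) := (hX n).mono (ℱ.le _) le_rfl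
    have hT := measurable_sum_range_of_adapted ℱ hX n
    have hTD := ae_abs_sum_range_le hXe'
    have hint := integrable_exp_mul_of_ae_abs_le (hT.mono (ℱ.le _) le_rfl) hTD t
    have hXint : Integrable (X n) P :=
      Integrable.of_bound hXn.aestronglyMeasurable (e n) (hXe n (by omega))
    have hgC : ∀ᵐ ω ∂P, |Real.exp (t * ∑ i ∈ Finset.range n, X i ω)| ≤
        Real.exp (|t| * ∑ i ∈ Finset.range n, e i) := by
      filter_upwards [hTD] with ω hω
      rw [Real.abs_exp, Real.exp_le_exp]
      refine (le_abs_self _).trans ?_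
      rw [abs_mul]
      gcongr
    have hgm : Measurable[ℱ n] fun ω => Real.exp (t * ∑ i ∈ Finset.range n, X i ω) :=
      Real.measurable_exp.comp (hT.const_mul t)
    have hzero := integral_mul_eq_zero_of_condExp_eq_zero (ℱ.le n) hgm hgC hXint
      (hX0 n (by omega))
    have hgX : Integrable
        (fun ω => Real.exp (t * ∑ i ∈ Finset.range n, X i ω) * X n ω) P :=
      hXint.bdd_mul hint.aestronglyMeasurable hgC
    have hle : ∀ᵐ ω ∂P, Real.exp (t * ∑ i ∈ Finset.range (n + 1), X i ω) ≤
        Real.exp (t * ∑ i ∈ Finset.range n, X i ω) * Real.cosh (t * e n) +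
        (Real.exp (t * ∑ i ∈ Finset.range n, X i ω) * X n ω) *
          (Real.sinh (t * e n) / e n) := by
      filter_upwards [hXe n (by omega)] with ω hω
      rw [Finset.sum_range_succ, mul_add, Real.exp_add]
      refine (mul_le_mul_of_nonneg_left (Real.exp_mul_le_cosh_add_div_mul_sinh hω t)
        (Real.exp_pos _).le).trans_eq ?_
      ring
    calc _ ≤ ∫ ω, (Real.exp (t * ∑ i ∈ Finset.range n, X i ω) * Real.cosh (t * e n) +
        (Real.exp (t * ∑ i ∈ Finset.range n, X i ω) * X n ω) *
          (Real.sinh (t * e n) / e n)) ∂P :=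
          integral_mono_ae
            (integrable_exp_mul_of_ae_abs_le
              ((measurable_sum_range_of_adapted ℱ hX (n + 1)).mono (ℱ.le _) le_rfl)
              (ae_abs_sum_range_le hXe) t)
            ((hint.mul_const _).add (hgX.mul_const _)) hle
      _ = (∫ ω, Real.exp (t * ∑ i ∈ Finset.range n, X i ω) ∂P) * Real.cosh (t * e n) := by
          rw [integral_add (hint.mul_const _) (hgX.mul_const _), integral_mul_const,
            integral_mul_const, hzero, zero_mul, add_zero]
      _ ≤ Real.exp ((∑ i ∈ Finset.range n, e i ^ 2) * t ^ 2 / 2) *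
            Real.exp ((t * e n) ^ 2 / 2) :=
          mul_le_mul ih (Real.cosh_le_exp_half_sq _) (Real.cosh_pos _).le (Real.exp_pos _).le
      _ = _ := by
          rw [← Real.exp_add, Finset.sum_range_succ]
          ring_nf

/-- The Azuma–Hoeffding inequality. -/
theorem measureReal_le_sum_le_exp {Ω : Type*} {mΩ : MeasurableSpace Ω} {P : Measure Ω}
    [IsProbabilityMeasure P] (ℱ : Filtration ℕ mΩ) {X : ℕ → Ω → ℝ} {e : ℕ → ℝ}
    (hX : ∀ i, Measurable[ℱ (i + 1)] (X i)) {n : ℕ}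
    (hXe : ∀ i < n, ∀ᵐ ω ∂P, |X i ω| ≤ e i) (hX0 : ∀ i < n, P[X i | ℱ i] =ᵐ[P] 0)
    {s : ℝ} (hs : 0 ≤ s) :
    P.real {ω | s ≤ ∑ i ∈ Finset.range n, X i ω} ≤
      Real.exp (-s ^ 2 / (2 * ∑ i ∈ Finset.range n, e i ^ 2)) := by
  have hV : 0 ≤ ∑ i ∈ Finset.range n, e i ^ 2 := Finset.sum_nonneg fun _ _ => sq_nonneg _
  have h : HasSubgaussianMGF (fun ω => ∑ i ∈ Finset.range n, X i ω)
      ⟨∑ i ∈ Finset.range n, e i ^ 2, hV⟩ P :=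
    { integrable_exp_mul := integrable_exp_mul_of_ae_abs_le
        ((measurable_sum_range_of_adapted ℱ hX n).mono (ℱ.le _) le_rfl) (ae_abs_sum_range_le hXe)
      mgf_le := fun t => integral_exp_mul_sum_le ℱ hX t n hXe hX0 }
  exact h.measure_ge_le hs

/-- A Gaussian tail bound losing a factor `1 + δ`, together with a Markov-type bound, yields a
Gaussian tail bound with a worse variance proxy but without the loss. -/
theorem le_exp_of_le_mul_exp_of_mul_le {p γ δ V D R N : ℝ} (hγ : 0 < γ) (hδ : 0 ≤ δ)
    (hR : 0 ≤ R) (hV : 0 < V) (hD : 0 ≤ D) (hN : 1 ≤ N) (hVR : V ≤ N * R ^ 2)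
    (hDV : D ^ 2 ≤ N * V)
    (hp : p ≤ (1 + δ) * Real.exp (-(γ + N * δ * R) ^ 2 / (2 * V)))
    (hp' : p * (γ + N * δ * R + D) ≤ D + N * δ * R) :
    p ≤ Real.exp (-γ ^ 2 / (8 * V)) := by
  have ha : 0 ≤ N * δ * R := by positivity
  set a := N * δ * R with ha_def
  by_cases hc : δ * V ≤ (γ + a) ^ 2 / 2 - γ ^ 2 / 8
  · refine hp.trans ?_
    calc (1 + δ) * Real.exp (-(γ + a) ^ 2 / (2 * V))
        ≤ Real.exp δ * Real.exp (-(γ + a) ^ 2 / (2 * V)) := by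
          gcongr
          linarith [Real.add_one_le_exp δ]
      _ = Real.exp (δ + -(γ + a) ^ 2 / (2 * V)) := (Real.exp_add _ _).symm
      _ ≤ _ := by
          rw [Real.exp_le_exp, ← sub_nonneg]
          have : -γ ^ 2 / (8 * V) - (δ + -(γ + a) ^ 2 / (2 * V)) =
              ((γ + a) ^ 2 / 2 - γ ^ 2 / 8 - δ * V) / V := by
            field_simp
            ring
          rw [this]
          exact div_nonneg (by linarith) hV.le
  · push Not at hc
    have hγa : 0 ≤ γ * a := by positivity
    have hδV : 0 < δ * V := by nlinarith [sq_nonneg a, sq_nonneg γ]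
    have hδ0 : 0 < δ := pos_of_mul_pos_left hδV hV.le
    have hNδ : N * δ < 2 := by
      have h1 : a ^ 2 < 2 * (δ * V) := by nlinarith [sq_nonneg γ]
      have h2 : N * δ * (δ * V) ≤ a ^ 2 := by
        calc N * δ * (δ * V) ≤ N * δ * (δ * (N * R ^ 2)) := by gcongr
          _ = a ^ 2 := by rw [ha_def]; ring
      exact lt_of_mul_lt_mul_right (h2.trans_lt h1) hδV.le
    have hδ2 : δ < 2 := by nlinarith
    have hs : γ ^ 2 + γ * a ≤ 16 / 3 * V := by nlinarith [sq_nonneg a]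
    have hγD : γ * D ≤ 7 / 3 * V := by
      refine abs_le_of_sq_le_sq' ?_ (by positivity) |>.2
      have h1 : γ ^ 2 ≤ 8 / 3 * (δ * V) := by nlinarith [sq_nonneg a]
      calc (γ * D) ^ 2 = γ ^ 2 * D ^ 2 := by ring
        _ ≤ 8 / 3 * (δ * V) * (N * V) := by gcongr
        _ = 8 / 3 * (N * δ) * V ^ 2 := by ring
        _ ≤ 8 / 3 * 2 * V ^ 2 := by gcongr
        _ ≤ (7 / 3 * V) ^ 2 := by nlinarith [sq_nonneg V]
    have hpos : 0 < γ + a + D := by positivity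
    have h1 : p ≤ 1 - γ / (γ + a + D) := by
      rw [show 1 - γ / (γ + a + D) = (D + a) / (γ + a + D) by field_simp; ring, le_div_iff₀ hpos]
      exact hp'
    have h2 : γ ^ 2 / (8 * V) ≤ γ / (γ + a + D) := by
      rw [div_le_div_iff₀ (by positivity) hpos]
      nlinarith
    have h3 := Real.add_one_le_exp (-γ ^ 2 / (8 * V))
    rw [neg_div] at h3 ⊢
    linarith

/-- Markov-type bound on an event for a bounded centred variable. -/
theorem measureReal_inter_mul_le {Ω : Type*} {mΩ : MeasurableSpace Ω} {P : Measure Ω}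
    [IsProbabilityMeasure P] {T : Ω → ℝ} (hT : Measurable T) {D : ℝ}
    (hTD : ∀ᵐ ω ∂P, |T ω| ≤ D) (hT0 : ∫ ω, T ω ∂P = 0) {E : Set Ω} (hE : MeasurableSet E)
    (s : ℝ) :
    P.real (E ∩ {ω | s ≤ T ω}) * (s + D) ≤ D * P.real E + D * P.real Eᶜ := by
  have hTi : Integrable T P := Integrable.of_bound hT.aestronglyMeasurable D hTD
  have hB : MeasurableSet {ω | s ≤ T ω} := measurableSet_le measurable_const hT
  have hsplit := integral_add_compl hE hTi
  have hc : -(D * P.real Eᶜ) ≤ ∫ ω in Eᶜ, T ω ∂P := by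
    have h : ∫ ω in Eᶜ, (-D) ∂P ≤ ∫ ω in Eᶜ, T ω ∂P :=
      integral_mono_ae (integrable_const _) hTi.integrableOn
        (ae_restrict_of_ae (hTD.mono fun ω hω => (abs_le.1 hω).1))
    simpa [mul_comm] using h
  have hEl : P.real (E ∩ {ω | s ≤ T ω}) * (s + D) - D * P.real E ≤ ∫ ω in E, T ω ∂P := by
    have hi : Integrable ({ω | s ≤ T ω}.indicator fun _ => s + D) (P.restrict E) :=
      (integrable_const _).indicator hB
    have h : ∫ ω in E, ({ω | s ≤ T ω}.indicator (fun _ => s + D) ω - D) ∂P ≤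
        ∫ ω in E, T ω ∂P := by
      refine integral_mono_ae (hi.sub (integrable_const _)) hTi.integrableOn
        (ae_restrict_of_ae (hTD.mono fun ω hω => ?_))
      by_cases hω' : s ≤ T ω
      · simp [Set.indicator, hω']
      · simpa [Set.indicator, hω'] using (abs_le.1 hω).1
    rw [integral_sub hi (integrable_const _), integral_indicator_const _ hB] at h
    simpa [measureReal_restrict_apply hB, Set.inter_comm, mul_comm] using h
  linarith

/-- Conditional Azuma–Hoeffding inequality for bounded martingale differences: the conditioning
is paid for by a shift of the threshold. -/
theorem measureReal_inter_le_exp_mul {Ω : Type*} {mΩ : MeasurableSpace Ω} {P : Measure Ω}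
    [IsProbabilityMeasure P] (ℱ : Filtration ℕ mΩ) {X : ℕ → Ω → ℝ} {e : ℕ → ℝ}
    (hX : ∀ i, Measurable[ℱ (i + 1)] (X i)) {n : ℕ}
    (hXe : ∀ i < n, ∀ᵐ ω ∂P, |X i ω| ≤ e i) (hX0 : ∀ i < n, P[X i | ℱ i] =ᵐ[P] 0)
    {R : ℝ} (heR : ∀ i < n, e i ≤ R) {E : Set Ω} (hE : MeasurableSet E) (hE0 : 0 < P.real E)
    {V : ℝ} (hV : ∑ i ∈ Finset.range n, e i ^ 2 ≤ V) {γ : ℝ} (hγ : 0 < γ) :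
    P.real (E ∩ {ω | γ + n * (P.real Eᶜ / P.real E) * R ≤ ∑ i ∈ Finset.range n, X i ω}) ≤
      Real.exp (-γ ^ 2 / (8 * V)) * P.real E := by
  have he : ∀ i < n, 0 ≤ e i := fun i hi => by
    obtain ⟨ω, hω⟩ := (hXe i hi).exists
    exact (abs_nonneg _).trans hω
  have hXm : ∀ i, Measurable (X i) := fun i => (hX i).mono (ℱ.le _) le_rfl
  have hTm : Measurable fun ω => ∑ i ∈ Finset.range n, X i ω :=
    (measurable_sum_range_of_adapted ℱ hX n).mono (ℱ.le _) le_rfl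
  have hTD := ae_abs_sum_range_le hXe
  have hT0 : ∫ ω, ∑ i ∈ Finset.range n, X i ω ∂P = 0 := by
    rw [integral_finsetSum _ fun i hi => Integrable.of_bound (hXm i).aestronglyMeasurable (e i)
      (hXe i (Finset.mem_range.1 hi))]
    refine Finset.sum_eq_zero fun i hi => ?_
    rw [← integral_condExp (ℱ.le i), integral_congr_ae (hX0 i (Finset.mem_range.1 hi))]
    simp
  set V' := ∑ i ∈ Finset.range n, e i ^ 2 with hV'
  set D := ∑ i ∈ Finset.range n, e i with hD
  set δ := P.real Eᶜ / P.real E with hδ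
  have hδ0 : 0 ≤ δ := by positivity
  have hD0 : 0 ≤ D := Finset.sum_nonneg fun i hi => he i (Finset.mem_range.1 hi)
  have hDR : D ≤ n * R := by
    simpa using Finset.sum_le_sum fun i hi => heR i (Finset.mem_range.1 hi)
  have hV'0 : 0 ≤ V' := Finset.sum_nonneg fun _ _ => sq_nonneg _
  have ha : D * δ ≤ n * δ * R := by nlinarith
  have ha0 : 0 ≤ n * δ * R := (mul_nonneg hD0 hδ0).trans ha
  rcases hV'0.eq_or_lt with hV0 | hVpos
  · have hDz : D = 0 := Finset.sum_eq_zero fun i hi => by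
      have := (Finset.sum_eq_zero_iff_of_nonneg fun _ _ => sq_nonneg _).1 hV0.symm i hi
      exact pow_eq_zero_iff two_ne_zero |>.1 this
    have hnull : P {ω | γ + n * δ * R ≤ ∑ i ∈ Finset.range n, X i ω} = 0 := by
      rw [measure_eq_zero_iff_ae_notMem]
      filter_upwards [hTD] with ω hω hmem
      have := (abs_le.1 hω).2
      linarith
    rw [measureReal_def, measure_mono_null Set.inter_subset_right hnull]
    simp only [ENNReal.toReal_zero]
    positivity
  · have hn : n ≠ 0 := by
      rintro rfl
      simp [hV'] at hVpos
    have hN : (1 : ℝ) ≤ n := by exact_mod_cast Nat.one_le_iff_ne_zero.2 hn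
    have hR : 0 ≤ R := (he 0 (by omega)).trans (heR 0 (by omega))
    have hVR : V' ≤ n * R ^ 2 := by
      simpa using Finset.sum_le_sum fun i hi => pow_le_pow_left₀ (he i (Finset.mem_range.1 hi))
        (heR i (Finset.mem_range.1 hi)) 2
    have hDV : D ^ 2 ≤ n * V' := by
      simpa using sq_sum_le_card_mul_sum_sq (s := Finset.range n) (f := e)
    have hcompl : P.real Eᶜ = δ * P.real E := by rw [hδ, div_mul_cancel₀ _ hE0.ne']
    have hone : (1 + δ) * P.real E = 1 := by
      rw [add_mul, one_mul, ← hcompl, probReal_compl_eq_one_sub hE]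
      ring
    rw [← div_le_iff₀ hE0]
    refine (le_exp_of_le_mul_exp_of_mul_le hγ hδ0 hR hVpos hD0 hN hVR hDV ?_ ?_).trans ?_
    · rw [div_le_iff₀ hE0, mul_right_comm (1 + δ), hone, one_mul]
      exact (measureReal_mono Set.inter_subset_right).trans
        (measureReal_le_sum_le_exp ℱ hX hXe hX0 (by positivity))
    · have h := measureReal_inter_mul_le hTm hTD hT0 hE (γ + n * δ * R)
      rw [div_mul_eq_mul_div, div_le_iff₀ hE0]
      refine h.trans ?_
      rw [hcompl]
      nlinarith
    · rw [Real.exp_le_exp, neg_div, neg_div, neg_le_neg_iff]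
      gcongr

/-- Azuma–Hoeffding with conditioning: let `S` be a martingale w.r.t. the
filtration `𝔉_i = σ(z_1,…,z_i)` with `S_0 = 0` and differences `ψ_i = S_i − S_{i−1}`
bounded as `|ψ_i| ≤ c_i` (with `c_i` an `𝔉_{i−1}`-measurable nonnegative variable) and
`|ψ_i| ≤ R̄` a.s.; with `E_n = ∩_{i=1}^n {c_i ≤ d_i}` of positive probability and
`δ_n = P(E_nᶜ)/P(E_n)`, for every `γ > 0`,
`P(S_n ≥ γ + n δ_n R̄ | E_n) ≤ exp(−γ²/(8 ∑_{i=1}^n d_i²))`. -/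
theorem stmt8
    {Ω : Type*} {mΩ : MeasurableSpace Ω} {Z : Type*} [mZ : MeasurableSpace Z]
    (P : Measure Ω) [IsProbabilityMeasure P] (n : ℕ)
    (z : ℕ → Ω → Z) (hz : ∀ i, Measurable (z i))
    (𝔉 : ℕ → MeasurableSpace Ω)
    (h𝔉 : ∀ i, 𝔉 i = ⨆ s ∈ Finset.Icc 1 i, MeasurableSpace.comap (z s) mZ)
    (h𝔉le : ∀ i, 𝔉 i ≤ mΩ)
    (S : ℕ → Ω → ℝ) (hS0 : ∀ ω, S 0 ω = 0)
    (hSmeas : ∀ i, Measurable[𝔉 i] (S i))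
    (hSint : ∀ i, Integrable (S i) P)
    (hmart : ∀ i : ℕ, P[S (i + 1) | 𝔉 i] =ᵐ[P] S i)
    (ψ : ℕ → Ω → ℝ) (hψ : ∀ i ω, ψ i ω = S i ω - S (i - 1) ω)
    (hψzero : ∀ i : ℕ, 1 ≤ i → P[ψ i | 𝔉 (i - 1)] =ᵐ[P] 0)
    (c : ℕ → Ω → ℝ) (hc0 : ∀ i ω, 0 ≤ c i ω)
    (hcm : ∀ i, Measurable[𝔉 (i - 1)] (c i))
    (hψc : ∀ i ∈ Finset.Icc 1 n, ∀ᵐ ω ∂P, |ψ i ω| ≤ c i ω)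
    (Rbar : ℝ) (hψR : ∀ i ∈ Finset.Icc 1 n, ∀ᵐ ω ∂P, |ψ i ω| ≤ Rbar)
    (d : ℕ → ℝ)
    (En : Set Ω) (hEn : En = ⋂ i ∈ Finset.Icc 1 n, {ω | c i ω ≤ d i})
    (hEnpos : 0 < P En)
    (δ : ℝ) (hδ : δ = (P Enᶜ).toReal / (P En).toReal)
    (γ : ℝ) (hγ : 0 < γ) :
    P[|En] {ω | γ + n * δ * Rbar ≤ S n ω} ≤
      ENNReal.ofReal (Real.exp (-γ ^ 2 / (8 * ∑ i ∈ Finset.Icc 1 n, (d i) ^ 2))) := by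
  have hmono : Monotone 𝔉 := fun i j hij => by
    rw [h𝔉 i, h𝔉 j]
    exact biSup_mono fun s hs => Finset.Icc_subset_Icc_right hij hs
  let ℱ : Filtration ℕ mΩ := ⟨𝔉, hmono, h𝔉le⟩
  let A : ℕ → Set Ω := fun i => {ω | c i ω ≤ d i}
  have hA : ∀ i, MeasurableSet[𝔉 (i - 1)] (A i) := fun i =>
    measurableSet_le (hcm i) measurable_const
  have hψm : ∀ i, Measurable[𝔉 i] (ψ i) := fun i => by
    rw [funext (hψ i)]
    exact (hSmeas i).sub ((hSmeas (i - 1)).mono (hmono (Nat.sub_le _ _)) le_rfl)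
  have hψi : ∀ i, Integrable (ψ i) P := fun i => by
    rw [funext (hψ i)]
    exact (hSint i).sub (hSint (i - 1))
  have hEm : MeasurableSet En := by
    rw [hEn]
    exact Finset.measurableSet_biInter _ fun i _ => h𝔉le _ _ (hA i)
  have hE0 : 0 < P.real En := ENNReal.toReal_pos hEnpos.ne' (measure_ne_top _ _)
  obtain ⟨ω₀, hω₀⟩ := nonempty_of_measure_ne_zero hEnpos.ne'
  have hmem : ∀ i < n, i + 1 ∈ Finset.Icc 1 n := fun i hi =>
    Finset.mem_Icc.2 ⟨by omega, by omega⟩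
  have hEA : ∀ ω ∈ En, ∀ i < n, ω ∈ A (i + 1) := fun ω hω i hi => by
    rw [hEn] at hω
    exact Set.mem_iInter₂.1 hω (i + 1) (hmem i hi)
  have hd : ∀ i < n, 0 ≤ d (i + 1) := fun i hi => (hc0 _ _).trans (hEA ω₀ hω₀ i hi)
  have hR : ∀ i < n, 0 ≤ Rbar := fun i hi => by
    obtain ⟨ω, hω⟩ := (hψR (i + 1) (hmem i hi)).exists
    exact (abs_nonneg _).trans hω
  have hsum : ∑ i ∈ Finset.Icc 1 n, (d i) ^ 2 = ∑ i ∈ Finset.range n, d (i + 1) ^ 2 := by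
    rw [Finset.range_eq_Ico, Finset.sum_Ico_add' (fun i => d i ^ 2)]
    rfl
  have hV : ∑ i ∈ Finset.range n, (min (d (i + 1)) Rbar) ^ 2 ≤
      ∑ i ∈ Finset.Icc 1 n, (d i) ^ 2 := by
    rw [hsum]
    refine Finset.sum_le_sum fun i hi => ?_
    have hi' := Finset.mem_range.1 hi
    exact pow_le_pow_left₀ (le_min (hd i hi') (hR i hi')) (min_le_left _ _) 2
  have key := measureReal_inter_le_exp_mul (P := P) ℱ
    (X := fun i => (A (i + 1)).indicator (ψ (i + 1)))
    (e := fun i => min (d (i + 1)) Rbar) (n := n)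
    (fun i => (hψm (i + 1)).indicator (hmono (Nat.le_succ i) _ (hA (i + 1))))
    (fun i hi => by
      filter_upwards [hψc _ (hmem i hi), hψR _ (hmem i hi)] with ω h1 h2
      by_cases hω : ω ∈ A (i + 1)
      · rw [Set.indicator_of_mem hω]
        exact le_min (h1.trans hω) h2
      · rw [Set.indicator_of_notMem hω, abs_zero]
        exact le_min (hd i hi) (hR i hi))
    (fun i hi => by
      filter_upwards [condExp_indicator (hψi (i + 1)) (hA (i + 1)),
        hψzero (i + 1) (by omega)] with ω h1 h2
      refine h1.trans ?_
      by_cases hω : ω ∈ A (i + 1)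
      · rw [Set.indicator_of_mem hω, h2]
      · rw [Set.indicator_of_notMem hω, Pi.zero_apply])
    (R := Rbar) (fun i _ => min_le_right _ _) hEm hE0 hV hγ
  have hS : ∀ ω ∈ En, S n ω = ∑ i ∈ Finset.range n, (A (i + 1)).indicator (ψ (i + 1)) ω := by
    intro ω hω
    rw [Finset.sum_congr rfl fun i hi =>
      (Set.indicator_of_mem (hEA ω hω i (Finset.mem_range.1 hi)) (ψ (i + 1))).trans
        (hψ (i + 1) ω)]
    simp only [Nat.add_sub_cancel]
    rw [Finset.sum_range_sub (fun i => S i ω), hS0, sub_zero]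
  have hset : En ∩ {ω | γ + n * δ * Rbar ≤ S n ω} =
      En ∩ {ω | γ + n * (P.real Enᶜ / P.real En) * Rbar ≤
        ∑ i ∈ Finset.range n, (A (i + 1)).indicator (ψ (i + 1)) ω} := by
    ext ω
    refine and_congr_right fun hω => ?_
    rw [Set.mem_ofPred_eq, Set.mem_ofPred_eq, hS ω hω, hδ]
    rfl
  rw [cond_apply hEm, hset, mul_comm, ← div_eq_mul_inv]
  refine ENNReal.div_le_of_le_mul ?_
  rw [← ofReal_measureReal, ← ofReal_measureReal (s := En),
    ← ENNReal.ofReal_mul (Real.exp_pos _).le]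
  exact ENNReal.ofReal_le_ofReal key
end

section
/- For all t ≥ 0, V_{t+1} ≤ C/((1 − α)(t + E + 2)^α) + V₀·(1 + E)/(t + E + 2). -/
/-- Increment bound for `x ↦ x ^ (1 - α)`, a form of Bernoulli's inequality. -/
lemma rpow_one_sub_add_le {α x : ℝ} (hα0 : 0 ≤ α) (hα1 : α ≤ 1) (hx : 0 ≤ x) :
    x ^ (1 - α) + (1 - α) / (x + 1) ^ α ≤ (x + 1) ^ (1 - α) := by
  have hx1 : 0 < x + 1 := by linarith
  have hbern : (1 + -(1 / (x + 1))) ^ (1 - α) ≤ 1 + (1 - α) * -(1 / (x + 1)) := by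
    refine rpow_one_add_le_one_add_mul_self ?_ (by linarith) (by linarith)
    rw [neg_le_neg_iff, div_le_one hx1]
    linarith
  have hdiv : 1 + -(1 / (x + 1)) = x / (x + 1) := by field_simp; ring
  rw [hdiv, Real.div_rpow hx hx1.le, div_le_iff₀ (Real.rpow_pos_of_pos hx1 _)] at hbern
  have hpow : (x + 1) ^ (1 - α) = (x + 1) / (x + 1) ^ α := by
    rw [Real.rpow_sub hx1, Real.rpow_one]
  have hsplit : (1 + (1 - α) * -(1 / (x + 1))) * (x + 1) ^ (1 - α)
      = (x + 1) ^ (1 - α) - (1 - α) / (x + 1) ^ α := by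
    have := Real.rpow_pos_of_pos hx1 α
    rw [hpow]
    field_simp
    ring
  linarith

/-- Weighted form of the unrolled recursion. -/
lemma mul_le_of_step_recursion {E C α : ℝ} (hE : 0 ≤ E) (hC : 0 ≤ C)
    (hα0 : 0 ≤ α) (hα1 : α < 1) {V : ℕ → ℝ}
    (hrec : ∀ t : ℕ, V (t + 1) ≤
        ((t + 1 + E) / (t + 2 + E)) * V t + C / (((t : ℝ) + E + 1) ^ α * (t + E + 2)))
    (t : ℕ) :
    (t + E + 1) * V t ≤ (1 + E) * V 0 + C / (1 - α) * ((t : ℝ) + E) ^ (1 - α) := by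
  have hα : 0 < 1 - α := by linarith
  induction t with
  | zero =>
    have : 0 ≤ C / (1 - α) * (((0 : ℕ) : ℝ) + E) ^ (1 - α) := by positivity
    push_cast at this ⊢
    linarith
  | succ t ih =>
    have ht : (0 : ℝ) ≤ t := t.cast_nonneg
    have hpos : 0 < (t : ℝ) + E + 1 := by linarith
    have hp := Real.rpow_pos_of_pos hpos α
    have hstep : ((t : ℝ) + E + 2) * V (t + 1)
        ≤ (t + E + 1) * V t + C / ((t : ℝ) + E + 1) ^ α := by
      have h2 : 0 < (t : ℝ) + E + 2 := by linarith
      have h3 : (t : ℝ) + 2 + E ≠ 0 := by linarith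
      calc ((t : ℝ) + E + 2) * V (t + 1) ≤ _ := mul_le_mul_of_nonneg_left (hrec t) h2.le
        _ = _ := by
          rw [show (t : ℝ) + 2 + E = t + E + 2 by ring]
          field_simp
          ring
    have hinc := mul_le_mul_of_nonneg_left
      (rpow_one_sub_add_le hα0 hα1.le (show 0 ≤ (t : ℝ) + E by linarith))
      (div_nonneg hC hα.le)
    have hcancel : C / (1 - α) * ((1 - α) / ((t : ℝ) + E + 1) ^ α)
        = C / ((t : ℝ) + E + 1) ^ α := by
      field_simp
    rw [mul_add, hcancel] at hinc
    push_cast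
    rw [show (t : ℝ) + 1 + E = t + E + 1 by ring, show (t : ℝ) + E + 1 + 1 = t + E + 2 by ring]
    linarith


/-- unrolling step of Corollary "VtBoundTighter": if a nonnegative sequence
satisfies `V_{t+1} ≤ ((t+1+E)/(t+2+E)) V_t + C/((t+E+1)^α (t+E+2))` with `E, C ≥ 0` and
`α ∈ [0,1)`, then for all `t ≥ 0`,
`V_{t+1} ≤ C/((1−α)(t+E+2)^α) + V₀(1+E)/(t+E+2)`. -/
theorem stmt11
    (E C : ℝ) (hE : 0 ≤ E) (hC : 0 ≤ C)
    (α : ℝ) (hα0 : 0 ≤ α) (hα1 : α < 1)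
    (V : ℕ → ℝ) (hV : ∀ t : ℕ, 0 ≤ V t)
    (hrec : ∀ t : ℕ, V (t + 1) ≤
        ((t + 1 + E) / (t + 2 + E)) * V t + C / (((t : ℝ) + E + 1) ^ α * (t + E + 2))) :
    ∀ t : ℕ, V (t + 1) ≤
      C / ((1 - α) * ((t : ℝ) + E + 2) ^ α) + V 0 * (1 + E) / (t + E + 2) := by
  intro t
  have hα : 0 < 1 - α := by linarith
  have ht : (0 : ℝ) ≤ t := t.cast_nonneg
  have h2 : 0 < (t : ℝ) + E + 2 := by linarith
  have hp := Real.rpow_pos_of_pos h2 α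
  have hbound := mul_le_of_step_recursion hE hC hα0 hα1 hrec (t + 1)
  push_cast at hbound
  rw [show (t : ℝ) + 1 + E + 1 = t + E + 2 by ring] at hbound
  have hmono : ((t : ℝ) + 1 + E) ^ (1 - α) ≤ (t + E + 2) / ((t : ℝ) + E + 2) ^ α :=
    calc ((t : ℝ) + 1 + E) ^ (1 - α) ≤ ((t : ℝ) + E + 2) ^ (1 - α) :=
          Real.rpow_le_rpow (by linarith) (by linarith) hα.le
      _ = _ := by rw [Real.rpow_sub h2, Real.rpow_one]
  have hmono' := mul_le_mul_of_nonneg_left hmono (div_nonneg hC hα.le)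
  have hrhs : C / ((1 - α) * ((t : ℝ) + E + 2) ^ α) + V 0 * (1 + E) / (t + E + 2)
      = ((1 + E) * V 0 + C / (1 - α) * ((t + E + 2) / ((t : ℝ) + E + 2) ^ α))
        / (t + E + 2) := by
    field_simp
    ring
  rw [hrhs, le_div_iff₀ h2]
  linarith
end

section
/- For every step size 0 < η ≤ 2/(κ²(μ + β)) and all w, w' ∈ W, the SGD updates driven by a common sample contract in mean square: E_{z∼p}[‖(w − η∇f(w; z)) − (w' − η∇f(w'; z))‖²] ≤ (1 − μη)·‖w − w'‖²; consequently E_{z∼p}[‖(w − η∇f(w; z)) − (w' − η∇f(w'; z))‖] ≤ (1 − μη/2)·‖w − w'‖. -/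
open MeasureTheory RealInnerProductSpace

/-- One-sided difference quotients converge to the directional derivative given by the gradient. -/
lemma HasGradientAt.tendsto_slope_right {W : Type*} [NormedAddCommGroup W]
    [InnerProductSpace ℝ W] [CompleteSpace W] {g : W → ℝ} {g' x : W}
    (h : HasGradientAt g g' x) (v : W) :
    Filter.Tendsto (fun t : ℝ => t⁻¹ * (g (x + t • v) - g x)) (nhdsWithin 0 (Set.Ioi 0))
      (nhds (inner ℝ g' v)) := by
  have h1 := (h.hasFDerivAt.hasLineDerivAt v).tendsto_slope_zero_right
  simpa using h1

/-- A convex function lies above its tangent planes. -/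
lemma ConvexOn.inner_gradient_le {W : Type*} [NormedAddCommGroup W]
    [InnerProductSpace ℝ W] [CompleteSpace W] {g : W → ℝ} {g' x : W}
    (hc : ConvexOn ℝ Set.univ g) (h : HasGradientAt g g' x) (y : W) :
    inner ℝ g' (y - x) ≤ g y - g x := by
  refine le_of_tendsto (h.tendsto_slope_right (y - x)) ?_
  filter_upwards [Ioo_mem_nhdsGT (zero_lt_one (α := ℝ))] with t ht
  have h1 := hc.2 (Set.mem_univ x) (Set.mem_univ y) (sub_nonneg.2 ht.2.le) ht.1.le (by ring)
  rw [show (1 - t) • x + t • y = x + t • (y - x) by module] at h1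
  simp only [smul_eq_mul] at h1
  rw [inv_mul_le_iff₀ ht.1]
  linarith

/-- A strongly convex function does not vanish on a short open segment issuing from a point. -/
lemma StrongConvexOn.exists_forall_ne_zero {W : Type*} [NormedAddCommGroup W]
    [InnerProductSpace ℝ W] {F : W → ℝ} {μ : ℝ} (hμ : 0 < μ)
    (hsc : StrongConvexOn Set.univ μ F) (w : W) {v : W} (hv : v ≠ 0) :
    ∃ δ > (0 : ℝ), ∀ t : ℝ, 0 < t → t < δ → F (w + t • v) ≠ 0 := by
  have key : ∀ a b c : ℝ, a < b → b < c → F (w + a • v) = 0 → F (w + b • v) = 0 →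
      F (w + c • v) = 0 → False := by
    intro a b c hab hbc ha hb hc
    have hne : w + a • v ≠ w + c • v := fun h =>
      (hab.trans hbc).ne (smul_left_injective ℝ hv (add_left_cancel h))
    have hac : 0 < c - a := by linarith
    have h := (hsc.strictConvexOn hμ).2 (Set.mem_univ _) (Set.mem_univ _) hne
      (div_pos (sub_pos.2 hbc) hac) (div_pos (sub_pos.2 hab) hac)
      (by field_simp; ring)
    have e : ((c - b) / (c - a)) • (w + a • v) + ((b - a) / (c - a)) • (w + c • v)
        = w + b • v := by
      match_scalars <;> field_simp <;> ring
    rw [e, ha, hb, hc] at h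
    simp at h
  by_contra! H
  obtain ⟨c, hc0, -, hc⟩ := H 1 one_pos
  obtain ⟨b, hb0, hbc, hb⟩ := H c hc0
  obtain ⟨a, ha0, hab, ha⟩ := H b hb0
  exact key a b c hab hbc ha hb hc

open Filter Topology in
/-- If the averaged loss is strongly convex, then every sample loss is integrable: the default
value `0` of the integral can only occur at few points. -/
lemma integrable_of_strongConvexOn_integral
    {W : Type*} [NormedAddCommGroup W] [InnerProductSpace ℝ W] [CompleteSpace W] [Nontrivial W]
    {Z : Type*} [MeasurableSpace Z] {p : Measure Z} [IsFiniteMeasure p]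
    {f : W → Z → ℝ} {f' : W → Z → W} {β μ : ℝ} (hμ : 0 < μ)
    (hgrad : ∀ z w, HasGradientAt (fun v => f v z) (f' w z) w)
    (hconv : ∀ z, ConvexOn ℝ Set.univ (fun v => f v z))
    (hsmooth : ∀ z w w', ‖f' w z - f' w' z‖ ≤ β * ‖w - w'‖)
    (hsc : StrongConvexOn Set.univ μ (fun w => ∫ z, f w z ∂p)) (w : W) :
    Integrable (f w) p := by
  obtain ⟨v, hv⟩ := exists_ne (0 : W)
  have hint : ∀ u, (∫ z, f u z ∂p) ≠ 0 → Integrable (f u) p := fun u hu => by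
    by_contra h
    exact hu (integral_undef h)
  obtain ⟨δ₁, hδ₁, h₁⟩ := hsc.exists_forall_ne_zero hμ w hv
  obtain ⟨δ₂, hδ₂, h₂⟩ := hsc.exists_forall_ne_zero hμ w (neg_ne_zero.2 hv)
  have hmeas : AEStronglyMeasurable (f w) p := by
    have hlim : Tendsto (fun n : ℕ => w + (δ₁ / ((n : ℝ) + 2)) • v) atTop (𝓝 w) := by
      have h0 : Tendsto (fun n : ℕ => δ₁ / ((n : ℝ) + 2)) atTop (𝓝 0) :=
        tendsto_const_nhds.div_atTop
          (tendsto_atTop_add_const_right _ _ tendsto_natCast_atTop_atTop)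
      simpa using (h0.smul_const v).const_add w
    refine aestronglyMeasurable_of_tendsto_ae atTop
      (f := fun (n : ℕ) => f (w + (δ₁ / ((n : ℝ) + 2)) • v))
      (fun n => (hint _ (h₁ _ (by positivity) ?_)).aestronglyMeasurable)
      (Eventually.of_forall fun z => ?_)
    · exact div_lt_self hδ₁ (by linarith [(n.cast_nonneg : (0 : ℝ) ≤ n)])
    · exact (hgrad z w).continuousAt.tendsto.comp hlim
  obtain ⟨t, ht0, ht⟩ := exists_between (lt_min hδ₁ hδ₂)
  have hp := hint _ (h₁ t ht0 (ht.trans_le (min_le_left _ _)))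
  have hm := hint _ (h₂ t ht0 (ht.trans_le (min_le_right _ _)))
  set a := w + t • v with ha
  set b := w + t • -v with hb
  have hupper : Integrable (fun z => (f a z + f b z) / 2) p := (hp.add hm).div_const 2
  have hlower : Integrable (fun z => (f a z + f b z) / 2 - β * ‖a - b‖ * ‖t • v‖ / 2) p :=
    hupper.sub (integrable_const _)
  refine integrable_of_le_of_le hmeas (Eventually.of_forall fun z => ?_)
    (Eventually.of_forall fun z => ?_) hlower hupper
  · have e1 := (hconv z).inner_gradient_le (hgrad z a) w
    have e2 := (hconv z).inner_gradient_le (hgrad z b) w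
    rw [show w - a = -(t • v) by rw [ha]; module, inner_neg_right] at e1
    rw [show w - b = t • v by rw [hb]; module] at e2
    have e3 : inner ℝ (f' a z - f' b z) (t • v) ≤ β * ‖a - b‖ * ‖t • v‖ :=
      (real_inner_le_norm _ _).trans (by gcongr; exact hsmooth z a b)
    rw [inner_sub_left] at e3
    linarith
  · have h := (hconv z).2 (Set.mem_univ a) (Set.mem_univ b)
      (one_half_pos (α := ℝ)).le (one_half_pos (α := ℝ)).le (add_halves 1)
    rw [show (1 / 2 : ℝ) • a + (1 / 2 : ℝ) • b = w by rw [ha, hb]; module] at h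
    simp only [smul_eq_mul] at h
    linarith

open Filter Topology in
/-- Directional derivatives of an integrable family are a.e. strongly measurable. -/
lemma aestronglyMeasurable_inner_gradient
    {W : Type*} [NormedAddCommGroup W] [InnerProductSpace ℝ W] [CompleteSpace W]
    {Z : Type*} [MeasurableSpace Z] {p : Measure Z} {f : W → Z → ℝ} {f' : W → Z → W}
    (hgrad : ∀ z w, HasGradientAt (fun v => f v z) (f' w z) w)
    (hmeas : ∀ w, AEStronglyMeasurable (f w) p) (w v : W) :
    AEStronglyMeasurable (fun z => inner ℝ (f' w z) v) p :=
  aestronglyMeasurable_of_tendsto_ae (𝓝[>] (0 : ℝ))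
    (f := fun t z => t⁻¹ * (f (w + t • v) z - f w z))
    (fun _ => ((hmeas _).sub (hmeas w)).const_mul _)
    (Eventually.of_forall fun z => (hgrad z w).tendsto_slope_right v)

open Filter Topology in
/-- The gradient of the averaged loss is strongly monotone, tested against sample gradients. -/
lemma mul_sq_norm_sub_le_integral_inner
    {W : Type*} [NormedAddCommGroup W] [InnerProductSpace ℝ W] [CompleteSpace W]
    {Z : Type*} [MeasurableSpace Z] {p : Measure Z}
    {f : W → Z → ℝ} {f' : W → Z → W} {μ : ℝ}
    (hgrad : ∀ z w, HasGradientAt (fun v => f v z) (f' w z) w)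
    (hconv : ∀ z, ConvexOn ℝ Set.univ (fun v => f v z))
    (hint : ∀ w, Integrable (f w) p)
    (hsc : StrongConvexOn Set.univ μ (fun w => ∫ z, f w z ∂p)) (w w' : W)
    (hinner : Integrable (fun z => inner ℝ (f' w z - f' w' z) (w - w')) p) :
    μ * ‖w - w'‖ ^ 2 ≤ ∫ z, inner ℝ (f' w z - f' w' z) (w - w') ∂p := by
  have hlim : Tendsto (fun t : ℝ => (1 - t) * (μ * ‖w - w'‖ ^ 2)) (𝓝[>] 0)
      (𝓝 (μ * ‖w - w'‖ ^ 2)) := by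
    have h : Continuous (fun t : ℝ => (1 - t) * (μ * ‖w - w'‖ ^ 2)) := by fun_prop
    simpa using (h.tendsto 0).mono_left nhdsWithin_le_nhds
  refine le_of_tendsto hlim ?_
  filter_upwards [Ioo_mem_nhdsGT (zero_lt_one (α := ℝ))] with t ht
  have hsum : ∀ z, t * -inner ℝ (f' w z - f' w' z) (w - w') ≤
      (f ((1 - t) • w + t • w') z - f w z) + (f (t • w + (1 - t) • w') z - f w' z) := by
    intro z
    have e1 := (hconv z).inner_gradient_le (hgrad z w) ((1 - t) • w + t • w')
    have e2 := (hconv z).inner_gradient_le (hgrad z w') (t • w + (1 - t) • w')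
    rw [show (1 - t) • w + t • w' - w = (-t) • (w - w') by module, inner_smul_right] at e1
    rw [show t • w + (1 - t) • w' - w' = t • (w - w') by module, inner_smul_right] at e2
    rw [inner_sub_left]
    linarith
  have hmono := integral_mono (hinner.neg.const_mul t)
    (((hint ((1 - t) • w + t • w')).sub (hint w)).add
      ((hint (t • w + (1 - t) • w')).sub (hint w'))) hsum
  rw [integral_const_mul, integral_neg',
    integral_add' ((hint _).sub (hint w)) ((hint _).sub (hint w')),
    integral_sub' (hint _) (hint w), integral_sub' (hint _) (hint w')] at hmono
  have s1 := hsc.2 (Set.mem_univ w) (Set.mem_univ w') (sub_nonneg.2 ht.2.le) ht.1.le (by ring)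
  have s2 := hsc.2 (Set.mem_univ w) (Set.mem_univ w') ht.1.le (sub_nonneg.2 ht.2.le) (by ring)
  simp only [smul_eq_mul] at s1 s2
  refine le_of_mul_le_mul_left ?_ ht.1
  linarith

/-- coupled SGD contraction: for any step size `0 < η ≤ 2/(κ²(μ+β))` and
models `w, w'`, the SGD updates driven by a common sample contract in mean square:
`E_z[‖(w − η∇f(w;z)) − (w' − η∇f(w';z))‖²] ≤ (1 − μη)‖w − w'‖²`, and consequently
`E_z[‖(w − η∇f(w;z)) − (w' − η∇f(w';z))‖] ≤ (1 − μη/2)‖w − w'‖`. -/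
theorem stmt12
    {W : Type*} [NormedAddCommGroup W] [InnerProductSpace ℝ W] [FiniteDimensional ℝ W]
    {Z : Type*} [MeasurableSpace Z]
    (p : Measure Z) [IsProbabilityMeasure p]
    (f : W → Z → ℝ) (f' : W → Z → W)
    (β μ : ℝ) (hβ : 0 < β) (hμ : 0 < μ)
    (hgrad : ∀ z w, HasGradientAt (fun v => f v z) (f' w z) w)
    (hconv : ∀ z, ConvexOn ℝ Set.univ (fun v => f v z))
    (hsmooth : ∀ z w w', ‖f' w z - f' w' z‖ ≤ β * ‖w - w'‖)
    (F : W → ℝ) (hF : ∀ w, F w = ∫ z, f w z ∂p)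
    (hsc : StrongConvexOn Set.univ μ F)
    (κ : ℝ) (hκ : κ = β / μ)
    (η : ℝ) (hη0 : 0 < η) (hη : η ≤ 2 / (κ ^ 2 * (μ + β)))
    (w w' : W) :
    (∫ z, ‖(w - η • f' w z) - (w' - η • f' w' z)‖ ^ 2 ∂p ≤ (1 - μ * η) * ‖w - w'‖ ^ 2) ∧
    (∫ z, ‖(w - η • f' w z) - (w' - η • f' w' z)‖ ∂p ≤ (1 - μ * η / 2) * ‖w - w'‖) := by
  rcases eq_or_ne w w' with rfl | hne
  · simp
  have : Nontrivial W := ⟨w, w', hne⟩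
  obtain rfl : F = fun w => ∫ z, f w z ∂p := funext hF
  have hint := integrable_of_strongConvexOn_integral hμ hgrad hconv hsmooth hsc
  have hD : 0 < ‖w - w'‖ := norm_pos_iff.2 (sub_ne_zero.2 hne)
  have hD2 : 0 < ‖w - w'‖ ^ 2 := by positivity
  have hbound : ∀ z, ‖(inner ℝ (f' w z - f' w' z) (w - w') : ℝ)‖ ≤ β * ‖w - w'‖ ^ 2 := fun z =>
    (norm_inner_le_norm _ _).trans
      ((mul_le_mul_of_nonneg_right (hsmooth z w w') hD.le).trans_eq (by ring))
  have hinner : Integrable (fun z => inner ℝ (f' w z - f' w' z) (w - w')) p := by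
    refine Integrable.of_bound ?_ _ (Filter.Eventually.of_forall hbound)
    simp only [inner_sub_left]
    have hm := aestronglyMeasurable_inner_gradient hgrad (fun u => (hint u).aestronglyMeasurable)
    exact (hm w _).sub (hm w' _)
  have hmono := mul_sq_norm_sub_le_integral_inner hgrad hconv hint hsc w w' hinner
  have hμβ : μ ≤ β := by
    refine le_of_mul_le_mul_right (hmono.trans ?_) hD2
    calc ∫ z, inner ℝ (f' w z - f' w' z) (w - w') ∂p
        ≤ ∫ _, β * ‖w - w'‖ ^ 2 ∂p :=
          integral_mono hinner (integrable_const _) fun z => (le_abs_self _).trans (hbound z)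
      _ = β * ‖w - w'‖ ^ 2 := by simp
  have hηβ : η * β ^ 2 ≤ μ := by
    subst hκ
    rw [le_div_iff₀ (by positivity)] at hη
    have h1 : η * ((β / μ) ^ 2 * (μ + β)) = η * β ^ 2 * (μ + β) / μ ^ 2 := by
      field_simp
    rw [h1, div_le_iff₀ (by positivity)] at hη
    refine le_of_mul_le_mul_right (hη.trans ?_) (add_pos hμ hβ)
    nlinarith
  have hημ : μ * η ≤ 1 := by
    refine le_of_mul_le_mul_right ?_ hμ
    nlinarith [mul_le_mul_of_nonneg_left (pow_le_pow_left₀ hμ.le hμβ 2) hη0.le]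
  set G : Z → ℝ := fun z => ‖w - w'‖ ^ 2 - 2 * η * inner ℝ (f' w z - f' w' z) (w - w') +
    η ^ 2 * (β * ‖w - w'‖) ^ 2 with hG
  have hGint : Integrable G p :=
    ((integrable_const _).sub (hinner.const_mul _)).add (integrable_const _)
  have hle : ∀ z, ‖(w - η • f' w z) - (w' - η • f' w' z)‖ ^ 2 ≤ G z := fun z => by
    rw [show (w - η • f' w z) - (w' - η • f' w' z) = (w - w') - η • (f' w z - f' w' z) by module,
      norm_sub_sq_real, inner_smul_right, real_inner_comm, norm_smul, mul_pow, Real.norm_eq_abs,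
      sq_abs]
    have := mul_le_mul_of_nonneg_left
      (pow_le_pow_left₀ (norm_nonneg _) (hsmooth z w w') 2) (sq_nonneg η)
    simp only [hG]
    linarith
  have hGle : ∫ z, G z ∂p ≤ (1 - μ * η) * ‖w - w'‖ ^ 2 := by
    have hsub : Integrable
        (fun z => ‖w - w'‖ ^ 2 - 2 * η * inner ℝ (f' w z - f' w' z) (w - w')) p :=
      (integrable_const _).sub (hinner.const_mul _)
    rw [hG, integral_add hsub (integrable_const _), integral_sub (integrable_const _) (hinner.const_mul _), integral_const_mul]
    simp only [integral_const, probReal_univ, one_smul]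
    have h1 := mul_le_mul_of_nonneg_left hmono hη0.le
    have h2 := mul_le_mul_of_nonneg_left hηβ (mul_nonneg hη0.le hD2.le)
    linarith
  refine ⟨(integral_mono_of_nonneg (Filter.Eventually.of_forall fun z => by positivity) hGint
    (Filter.Eventually.of_forall hle)).trans hGle, ?_⟩
  set c := (1 - μ * η / 2) * ‖w - w'‖ with hc
  have hc0 : 0 < c := mul_pos (by linarith) hD
  calc ∫ z, ‖(w - η • f' w z) - (w' - η • f' w' z)‖ ∂p
      ≤ ∫ z, (G z + c ^ 2) / (2 * c) ∂p := by
        refine integral_mono_of_nonneg (Filter.Eventually.of_forall fun z => norm_nonneg _)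
          ((hGint.add (integrable_const _)).div_const _) (Filter.Eventually.of_forall fun z => ?_)
        dsimp only
        rw [le_div_iff₀ (by positivity)]
        linarith [hle z, two_mul_le_add_sq ‖(w - η • f' w z) - (w' - η • f' w' z)‖ c]
    _ = (∫ z, G z ∂p + c ^ 2) / (2 * c) := by
        rw [integral_div, integral_add hGint (integrable_const _)]
        simp
    _ ≤ c := by
        rw [div_le_iff₀ (by positivity)]
        have : (1 - μ * η) * ‖w - w'‖ ^ 2 ≤ c ^ 2 := by
          rw [hc, mul_pow]
          exact mul_le_mul_of_nonneg_right (by linarith [sq_nonneg (μ * η)]) hD2.le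
        linarith
end

section
/- For every w ∈ W and z ∈ Z, ‖∇f(w; z)‖² ≤ 2β²κ‖w − w*‖² + 2𝒢; consequently, the SGD iterates with step sizes η_t = 2/(μ(t + E)) satisfy, for every t, d_{t+1} ≤ (1 + 2√(2κ)·β/(μ(t + E)))·d_t + 2√(2𝒢)/(μ(t + E)). -/
open MeasureTheory RealInnerProductSpace

/-- Second differences of a function with `β`-Lipschitz gradient are at most `β‖h‖²`. -/
lemma add_sub_two_mul_le_of_lipschitz_gradient
    {W : Type*} [NormedAddCommGroup W] [InnerProductSpace ℝ W] [CompleteSpace W]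
    {f : W → ℝ} {f' : W → W} {β : ℝ} (hgrad : ∀ w, HasGradientAt f (f' w) w)
    (hsmooth : ∀ w w', ‖f' w - f' w'‖ ≤ β * ‖w - w'‖) (a h : W) :
    f (a + h) + f (a - h) - 2 * f a ≤ β * ‖h‖ ^ 2 := by
  let φ : ℝ → ℝ := fun t => f (a + t • h) + f (a - t • h) - β * ‖h‖ ^ 2 * t ^ 2
  let φ' : ℝ → ℝ := fun t =>
    ⟪f' (a + t • h) - f' (a - t • h), h⟫ - 2 * β * ‖h‖ ^ 2 * t
  have hφ : ∀ t, HasDerivAt φ (φ' t) t := by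
    intro t
    have hline : HasDerivAt (fun t : ℝ => t • h) h t := by
      simpa using (hasDerivAt_id t).smul_const h
    have h₁ := (hgrad (a + t • h)).hasFDerivAt.comp_hasDerivAt t (hline.const_add a)
    have h₂ := (hgrad (a - t • h)).hasFDerivAt.comp_hasDerivAt t (hline.const_sub a)
    have h₃ := ((hasDerivAt_id t).pow 2).const_mul (β * ‖h‖ ^ 2)
    refine ((h₁.add h₂).sub h₃).congr_deriv ?_
    simp only [InnerProductSpace.toDual_apply_apply, inner_neg_right, id, φ', inner_sub_left]
    norm_num
    ring
  have hanti : AntitoneOn φ (Set.Icc 0 1) := by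
    refine antitoneOn_of_deriv_nonpos (convex_Icc 0 1)
      (fun t _ => (hφ t).continuousAt.continuousWithinAt)
      (fun t _ => (hφ t).differentiableAt.differentiableWithinAt) ?_
    intro t ht
    rw [interior_Icc] at ht
    rw [(hφ t).deriv]
    have hn : ‖(a + t • h) - (a - t • h)‖ = 2 * t * ‖h‖ := by
      rw [show (a + t • h) - (a - t • h) = (2 * t) • h by module, norm_smul,
        Real.norm_of_nonneg (by linarith [ht.1])]
    have hb := hsmooth (a + t • h) (a - t • h)
    rw [hn] at hb
    have hi := real_inner_le_norm (f' (a + t • h) - f' (a - t • h)) h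
    have := mul_le_mul_of_nonneg_right hb (norm_nonneg h)
    simp only [φ']
    linarith
  have h01 := hanti (Set.left_mem_Icc.2 zero_le_one) (Set.right_mem_Icc.2 zero_le_one) zero_le_one
  simp only [φ, one_smul, zero_smul, add_zero, sub_zero] at h01
  linarith

lemma StrongConvexOn.two_mul_add_le
    {W : Type*} [NormedAddCommGroup W] [InnerProductSpace ℝ W] {F : W → ℝ} {μ : ℝ}
    (hF : StrongConvexOn Set.univ μ F) (a h : W) :
    2 * F a + μ * ‖h‖ ^ 2 ≤ F (a + h) + F (a - h) := by
  obtain ⟨-, hineq⟩ := hF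
  have key := hineq (Set.mem_univ (a + h)) (Set.mem_univ (a - h))
    (a := 1 / 2) (b := 1 / 2) (by norm_num) (by norm_num) (by norm_num)
  rw [show (1 / 2 : ℝ) • (a + h) + (1 / 2 : ℝ) • (a - h) = a by module,
    show (a + h) - (a - h) = (2 : ℝ) • h by module, norm_smul] at key
  norm_num at key
  nlinarith

/-- Quadratic growth of a strongly convex function away from its minimizer. -/
lemma StrongConvexOn.quadratic_growth
    {W : Type*} [NormedAddCommGroup W] [InnerProductSpace ℝ W] {F : W → ℝ} {μ : ℝ}
    (hF : StrongConvexOn Set.univ μ F) {x : W} (hx : ∀ w, F x ≤ F w) (u : W) :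
    F x + μ / 4 * ‖u‖ ^ 2 ≤ F (x + u) := by
  have key := hF.two_mul_add_le (x + (1 / 2 : ℝ) • u) ((1 / 2 : ℝ) • u)
  rw [show x + (1 / 2 : ℝ) • u + (1 / 2 : ℝ) • u = x + u by module,
    show x + (1 / 2 : ℝ) • u - (1 / 2 : ℝ) • u = x by module, norm_smul] at key
  norm_num at key
  linarith [hx (x + (1 / 2 : ℝ) • u)]

/-- If an average of functions with `β`-Lipschitz gradients is `μ`-strongly convex with a
minimizer, then `μ ≤ β`. No integrability is assumed: points far from the minimizer have a
nonzero average, so the functions are integrable there. -/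
lemma StrongConvexOn.le_of_average_lipschitz_gradient
    {W : Type*} [NormedAddCommGroup W] [InnerProductSpace ℝ W] [CompleteSpace W] [Nontrivial W]
    {Z : Type*} [MeasurableSpace Z] {p : Measure Z} [IsProbabilityMeasure p]
    {f : W → Z → ℝ} {f' : W → Z → W} {β μ : ℝ} (hμ : 0 < μ)
    (hgrad : ∀ z w, HasGradientAt (fun v => f v z) (f' w z) w)
    (hsmooth : ∀ z w w', ‖f' w z - f' w' z‖ ≤ β * ‖w - w'‖)
    {F : W → ℝ} (hF : ∀ w, F w = ∫ z, f w z ∂p) (hsc : StrongConvexOn Set.univ μ F)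
    {x : W} (hx : ∀ w, F x ≤ F w) : μ ≤ β := by
  obtain ⟨h, hh⟩ := exists_norm_eq W zero_le_one
  let T : ℝ := 1 + 4 * |F x| / μ
  have hT : 1 ≤ T := by simp only [T]; linarith [show 0 ≤ 4 * |F x| / μ by positivity]
  have hint : ∀ t : ℝ, T ≤ t → Integrable (f (x + t • h)) p := by
    intro t ht
    by_contra hnot
    have hzero : F (x + t • h) = 0 := by rw [hF, integral_undef hnot]
    have hgrow := hsc.quadratic_growth hx (t • h)
    rw [hzero, norm_smul, hh, mul_one, Real.norm_eq_abs, sq_abs] at hgrow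
    have hTμ : μ * T = μ + 4 * |F x| := by simp only [T]; field_simp
    have hsq : T ≤ t ^ 2 := by nlinarith
    have := mul_le_mul_of_nonneg_left hsq hμ.le
    linarith [neg_abs_le (F x)]
  have hplus := hint (T + 2) (by linarith)
  have hminus := hint T le_rfl
  have hmid := hint (T + 1) (by linarith)
  rw [show x + (T + 2) • h = x + (T + 1) • h + h by module] at hplus
  rw [show x + T • h = x + (T + 1) • h - h by module] at hminus
  set a := x + (T + 1) • h
  have hsum : Integrable (fun z => f (a + h) z + f (a - h) z) p := hplus.add hminus
  have hupper : F (a + h) + F (a - h) - 2 * F a ≤ β := by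
    rw [hF, hF, hF, ← integral_add hplus hminus, ← integral_const_mul,
      ← integral_sub hsum (hmid.const_mul 2)]
    have hmono := integral_mono (hsum.sub (hmid.const_mul 2))
      (integrable_const (β * ‖h‖ ^ 2))
      (fun z => add_sub_two_mul_le_of_lipschitz_gradient (hgrad z) (hsmooth z) a h)
    simpa [hh] using hmono
  have hlower := hsc.two_mul_add_le a h
  rw [hh] at hlower
  linarith

/-- Remark "unifDiamBound": the stochastic gradient satisfies
`‖∇f(w; z)‖² ≤ 2β²κ‖w − w*‖² + 2𝒢` for all `w, z`; consequently, the SGD iterates with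
step sizes `η_t = 2/(μ(t+E))` satisfy
`d_{t+1} ≤ (1 + 2√(2κ)β/(μ(t+E))) d_t + 2√(2𝒢)/(μ(t+E))`. -/
theorem stmt14
    {W : Type*} [NormedAddCommGroup W] [InnerProductSpace ℝ W] [FiniteDimensional ℝ W]
    {Z : Type*} [MeasurableSpace Z]
    (p : Measure Z) [IsProbabilityMeasure p]
    (f : W → Z → ℝ) (f' : W → Z → W)
    (β μ 𝒢 : ℝ) (hβ : 0 < β) (hμ : 0 < μ) (h𝒢 : 0 ≤ 𝒢)
    (hgrad : ∀ z w, HasGradientAt (fun v => f v z) (f' w z) w)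
    (hconv : ∀ z, ConvexOn ℝ Set.univ (fun v => f v z))
    (hsmooth : ∀ z w w', ‖f' w z - f' w' z‖ ≤ β * ‖w - w'‖)
    (F : W → ℝ) (hF : ∀ w, F w = ∫ z, f w z ∂p)
    (hsc : StrongConvexOn Set.univ μ F)
    (wstar : W) (hmin : ∀ w, F wstar ≤ F w)
    (h𝒢b : ∀ z, ‖f' wstar z‖ ^ 2 ≤ 𝒢)
    (κ : ℝ) (hκ : κ = β / μ)
    (E : ℝ) (hE : 0 < E)
    (η : ℕ → ℝ) (hη : ∀ t : ℕ, η t = 2 / (μ * (t + E)))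
    (z : ℕ → Z) (w0 : W) (w : ℕ → W) (hw0 : w 0 = w0)
    (hrec : ∀ t : ℕ, w (t + 1) = w t - η t • f' (w t) (z t))
    (d : ℕ → ℝ) (hd : ∀ t : ℕ, d t = ‖w t - wstar‖) :
    (∀ (v : W) (zz : Z), ‖f' v zz‖ ^ 2 ≤ 2 * β ^ 2 * κ * ‖v - wstar‖ ^ 2 + 2 * 𝒢) ∧
    (∀ t : ℕ, d (t + 1) ≤
        (1 + 2 * Real.sqrt (2 * κ) * β / (μ * (t + E))) * d t
          + 2 * Real.sqrt (2 * 𝒢) / (μ * (t + E))) := by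
  have hκ0 : 0 < κ := hκ ▸ div_pos hβ hμ
  have hbound : ∀ (v : W) (zz : Z),
      ‖f' v zz‖ ^ 2 ≤ 2 * β ^ 2 * κ * ‖v - wstar‖ ^ 2 + 2 * 𝒢 := by
    intro v zz
    have hnorm : ‖f' v zz‖ ≤ β * ‖v - wstar‖ + ‖f' wstar zz‖ := by
      linarith [norm_sub_norm_le (f' v zz) (f' wstar zz), hsmooth zz v wstar]
    have hsq : ‖f' v zz‖ ^ 2 ≤ 2 * (β * ‖v - wstar‖) ^ 2 + 2 * 𝒢 := by
      have := pow_le_pow_left₀ (norm_nonneg _) hnorm 2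
      nlinarith [sq_nonneg (β * ‖v - wstar‖ - ‖f' wstar zz‖), h𝒢b zz]
    have hcond : (β * ‖v - wstar‖) ^ 2 ≤ κ * (β * ‖v - wstar‖) ^ 2 := by
      rcases eq_or_ne v wstar with rfl | hne
      · simp
      · have : Nontrivial W := ⟨v, wstar, hne⟩
        have hμβ : μ ≤ β := hsc.le_of_average_lipschitz_gradient hμ hgrad hsmooth hF hmin
        have hκ1 : 1 ≤ κ := by rwa [hκ, one_le_div hμ]
        exact le_mul_of_one_le_left (sq_nonneg _) hκ1
    linarith
  refine ⟨hbound, fun t => ?_⟩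
  have hden : 0 < μ * (t + E) := by positivity
  have hstep : ‖f' (w t) (z t)‖ ≤ √(2 * κ) * β * d t + √(2 * 𝒢) := by
    have hd0 : 0 ≤ d t := hd t ▸ norm_nonneg _
    refine le_of_sq_le_sq ?_ (by positivity)
    have hb := hbound (w t) (z t)
    rw [← hd t] at hb
    have hcross : 0 ≤ √(2 * κ) * β * d t * √(2 * 𝒢) := by positivity
    rw [add_sq, mul_pow, mul_pow, Real.sq_sqrt (by positivity), Real.sq_sqrt (by positivity)]
    linarith
  have hη0 : 0 ≤ η t := by rw [hη]; positivity
  calc d (t + 1) = ‖(w t - wstar) - η t • f' (w t) (z t)‖ := by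
        rw [hd, hrec, sub_right_comm]
    _ ≤ d t + η t * ‖f' (w t) (z t)‖ := by
        rw [hd t]
        simpa [norm_smul, abs_of_nonneg hη0] using norm_sub_le (w t - wstar) (η t • f' (w t) (z t))
    _ ≤ d t + η t * (√(2 * κ) * β * d t + √(2 * 𝒢)) := by gcongr
    _ = _ := by rw [hη]; ring
end

section
/- For every step size 0 < η ≤ 2/(κ²(μ + β)), all w, w' ∈ W, and independent random samples Z₁ ∼ p₁ and Z₂ ∼ p₂, the SGD updates driven by samples from the two different distributions satisfy E[‖(w − η∇f(w; Z₁)) − (w' − η∇f(w'; Z₂))‖] ≤ (1 − μη/2)·‖w − w'‖ + η·(√(2β²κ‖w' − w*₁‖² + 2𝒢₁) + √(2β²κ‖w' − w*₂‖² + 2𝒢₂)). -/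
open MeasureTheory RealInnerProductSpace

section GradientInequality

variable {W : Type*} [NormedAddCommGroup W] [InnerProductSpace ℝ W] [CompleteSpace W]

/-- Difference quotients along a direction converge to the inner product with the gradient. -/
theorem HasGradientAt.tendsto_natCast_mul_sub {g : W → ℝ} {g' w : W}
    (h : HasGradientAt g g' w) (e : W) :
    Filter.Tendsto (fun n : ℕ => ((n : ℝ) + 1) * (g (w + ((n : ℝ) + 1)⁻¹ • e) - g w))
      Filter.atTop (nhds ⟪g', e⟫) := by
  have hc : Filter.Tendsto (fun n : ℕ => ‖(n : ℝ) + 1‖) Filter.atTop Filter.atTop :=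
    tendsto_norm_atTop_atTop.comp
      (Filter.tendsto_atTop_add_const_right _ _ tendsto_natCast_atTop_atTop)
  simpa using h.hasFDerivAt.lim e hc

/-- The gradient inequality for a convex function. -/
theorem ConvexOn.inner_gradient_le_s15 {g : W → ℝ} {g' w : W} (hg : ConvexOn ℝ Set.univ g)
    (h : HasGradientAt g g' w) (e : W) : ⟪g', e⟫ ≤ g (w + e) - g w := by
  refine le_of_tendsto (h.tendsto_natCast_mul_sub e) (Filter.Eventually.of_forall fun n => ?_)
  have hn : (0 : ℝ) < (n : ℝ) + 1 := by positivity
  have ht1 : ((n : ℝ) + 1)⁻¹ ≤ 1 := inv_le_one_of_one_le₀ (by simp)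
  have key := hg.2 (Set.mem_univ w) (Set.mem_univ (w + e))
    (sub_nonneg.2 ht1) (inv_pos.2 hn).le (by ring)
  rw [show (1 - ((n : ℝ) + 1)⁻¹) • w + ((n : ℝ) + 1)⁻¹ • (w + e) = w + ((n : ℝ) + 1)⁻¹ • e by
    module] at key
  simp only [smul_eq_mul] at key
  calc ((n : ℝ) + 1) * (g (w + ((n : ℝ) + 1)⁻¹ • e) - g w)
      ≤ ((n : ℝ) + 1) * (((n : ℝ) + 1)⁻¹ * (g (w + e) - g w)) := by gcongr; linarith
    _ = g (w + e) - g w := by field_simp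

/-- A convex function is Lipschitz between two points where its gradients are bounded. -/
theorem ConvexOn.abs_sub_le_of_norm_gradient_le {g : W → ℝ} {g' : W → W}
    (hg : ConvexOn ℝ Set.univ g) (h : ∀ v, HasGradientAt g (g' v) v) {v w : W} {C : ℝ}
    (hv : ‖g' v‖ ≤ C) (hw : ‖g' w‖ ≤ C) : |g v - g w| ≤ C * ‖v - w‖ := by
  have h1 := hg.inner_gradient_le_s15 (h v) (w - v)
  have h2 := hg.inner_gradient_le_s15 (h w) (v - w)
  rw [add_sub_cancel] at h1 h2
  have h3 := (abs_le.1 (abs_real_inner_le_norm (g' v) (w - v))).1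
  have h4 := (abs_le.1 (abs_real_inner_le_norm (g' w) (v - w))).1
  rw [norm_sub_rev w v] at h3
  have h5 := mul_le_mul_of_nonneg_right hv (norm_nonneg (v - w))
  have h6 := mul_le_mul_of_nonneg_right hw (norm_nonneg (v - w))
  exact abs_le.2 ⟨by linarith, by linarith⟩

end GradientInequality

section StochasticGradient

variable {W : Type*} [NormedAddCommGroup W]
  {Z : Type*} {f : W → Z → ℝ} {f' : W → Z → W} {β μ 𝒢 : ℝ} {ws : W}

theorem norm_gradient_le_of_smooth
    (hsmooth : ∀ z w w', ‖f' w z - f' w' z‖ ≤ β * ‖w - w'‖)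
    (hb : ∀ z, ‖f' ws z‖ ^ 2 ≤ 𝒢) (w : W) (z : Z) :
    ‖f' w z‖ ≤ √𝒢 + β * ‖w - ws‖ := by
  have h1 : ‖f' ws z‖ ≤ √𝒢 := Real.le_sqrt_of_sq_le (hb z)
  have h2 := norm_add_le (f' ws z) (f' w z - f' ws z)
  rw [add_sub_cancel] at h2
  linarith [hsmooth z w ws]

theorem norm_gradient_le_sqrt_of_smooth
    (hsmooth : ∀ z w w', ‖f' w z - f' w' z‖ ≤ β * ‖w - w'‖)
    (hb : ∀ z, ‖f' ws z‖ ^ 2 ≤ 𝒢) {κ : ℝ} (hκ : 1 ≤ κ) (w : W) (z : Z) :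
    ‖f' w z‖ ≤ √(2 * β ^ 2 * κ * ‖w - ws‖ ^ 2 + 2 * 𝒢) := by
  apply Real.le_sqrt_of_sq_le
  have h2 := norm_add_le (f' ws z) (f' w z - f' ws z)
  rw [add_sub_cancel] at h2
  have h3 : ‖f' w z‖ ^ 2 ≤ (‖f' ws z‖ + ‖f' w z - f' ws z‖) ^ 2 := by gcongr
  have h4 : ‖f' w z - f' ws z‖ ^ 2 ≤ (β * ‖w - ws‖) ^ 2 := by
    gcongr; exact hsmooth z w ws
  have h5 : (β * ‖w - ws‖) ^ 2 ≤ κ * (β * ‖w - ws‖) ^ 2 :=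
    le_mul_of_one_le_left (sq_nonneg _) hκ
  nlinarith [sq_nonneg (‖f' ws z‖ - ‖f' w z - f' ws z‖), hb z]

variable [InnerProductSpace ℝ W] [MeasurableSpace Z] {p : Measure Z}

/-- Since a non-integrable loss has Bochner integral zero and a strongly convex function is not
constant near any point, the points with integrable loss are dense. -/
theorem StrongConvexOn.exists_integrable_near [Nontrivial W] (hμ : 0 < μ)
    (hsc : StrongConvexOn Set.univ μ fun w => ∫ z, f w z ∂p) (w : W) {ε : ℝ} (hε : 0 < ε) :
    ∃ v, ‖v - w‖ ≤ ε ∧ Integrable (f v) p := by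
  obtain ⟨u, hu⟩ := exists_norm_eq W hε.le
  by_contra! hcon
  have h0 := integral_undef (hcon w (by simpa using hε.le))
  have h1 := integral_undef (hcon (w + u) (by simp [hu]))
  have h2 := integral_undef (hcon (w - u) (by simp [hu]))
  have key := hsc.2 (Set.mem_univ (w + u)) (Set.mem_univ (w - u))
    (by norm_num : (0 : ℝ) ≤ 1 / 2) (by norm_num : (0 : ℝ) ≤ 1 / 2) (by norm_num)
  rw [show (1 / 2 : ℝ) • (w + u) + (1 / 2 : ℝ) • (w - u) = w by module] at key
  simp only [h0, h1, h2, show w + u - (w - u) = (2 : ℝ) • u by module, norm_smul, hu] at key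
  norm_num at key
  nlinarith [mul_pos hμ (pow_pos hε 2)]

variable [FiniteDimensional ℝ W]

/-- Integrability of the loss at every point is forced by strong convexity of its average. -/
theorem StrongConvexOn.integrable_loss [IsFiniteMeasure p] [Nontrivial W] (hμ : 0 < μ) (hβ : 0 ≤ β)
    (hgrad : ∀ z w, HasGradientAt (fun v => f v z) (f' w z) w)
    (hconv : ∀ z, ConvexOn ℝ Set.univ (fun v => f v z))
    (hsmooth : ∀ z w w', ‖f' w z - f' w' z‖ ≤ β * ‖w - w'‖)
    (hb : ∀ z, ‖f' ws z‖ ^ 2 ≤ 𝒢)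
    (hsc : StrongConvexOn Set.univ μ fun w => ∫ z, f w z ∂p) (w : W) :
    Integrable (f w) p := by
  have hpos (n : ℕ) : (0 : ℝ) < 1 / ((n : ℝ) + 1) := by positivity
  choose v hv hint using fun n : ℕ => hsc.exists_integrable_near hμ w (hpos n)
  have hlim : Filter.Tendsto v Filter.atTop (nhds w) :=
    tendsto_iff_norm_sub_tendsto_zero.2 (squeeze_zero (fun _ => norm_nonneg _) hv
      tendsto_one_div_add_atTop_nhds_zero_nat)
  have hmeas : AEStronglyMeasurable (f w) p :=
    aestronglyMeasurable_of_tendsto_ae Filter.atTop (fun n => (hint n).aestronglyMeasurable)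
      (Filter.Eventually.of_forall fun z => ((hgrad z w).continuousAt.tendsto.comp hlim))
  set C := √𝒢 + β * (‖w - ws‖ + ‖v 0 - ws‖)
  have hbd : ∀ z, ‖f w z - f (v 0) z‖ ≤ C * ‖w - v 0‖ := fun z =>
    (hconv z).abs_sub_le_of_norm_gradient_le (hgrad z)
      ((norm_gradient_le_of_smooth hsmooth hb w z).trans (by
        have := mul_nonneg hβ (norm_nonneg (v 0 - ws)); simp only [C]; linarith))
      ((norm_gradient_le_of_smooth hsmooth hb (v 0) z).trans (by
        have := mul_nonneg hβ (norm_nonneg (w - ws)); simp only [C]; linarith))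
  have hdiff : Integrable (fun z => f w z - f (v 0) z) p :=
    .of_bound (hmeas.sub (hint 0).aestronglyMeasurable) _ (Filter.Eventually.of_forall hbd)
  exact (hdiff.add (hint 0)).congr (Filter.Eventually.of_forall fun z => sub_add_cancel _ _)

theorem aestronglyMeasurable_gradient
    (hgrad : ∀ z w, HasGradientAt (fun v => f v z) (f' w z) w)
    (hint : ∀ w, Integrable (f w) p) (w : W) : AEStronglyMeasurable (f' w) p := by
  have hinner (e : W) : AEStronglyMeasurable (fun z => ⟪f' w z, e⟫) p :=
    aestronglyMeasurable_of_tendsto_ae Filter.atTop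
      (fun n : ℕ => (((hint (w + ((n : ℝ) + 1)⁻¹ • e)).sub (hint w)).const_mul
        ((n : ℝ) + 1)).aestronglyMeasurable)
      (Filter.Eventually.of_forall fun z => (hgrad z w).tendsto_natCast_mul_sub e)
  let b := stdOrthonormalBasis ℝ W
  have heq : f' w = fun z => ∑ i, ⟪f' w z, b i⟫ • b i := by
    funext z
    conv_lhs => rw [← b.sum_repr' (f' w z)]
    simp only [real_inner_comm]
  rw [heq]
  exact Finset.aestronglyMeasurable_fun_sum _ fun i _ => (hinner (b i)).smul_const (b i)

theorem integrable_gradient [IsFiniteMeasure p]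
    (hgrad : ∀ z w, HasGradientAt (fun v => f v z) (f' w z) w)
    (hsmooth : ∀ z w w', ‖f' w z - f' w' z‖ ≤ β * ‖w - w'‖)
    (hb : ∀ z, ‖f' ws z‖ ^ 2 ≤ 𝒢)
    (hint : ∀ w, Integrable (f w) p) (w : W) : Integrable (f' w) p :=
  .of_bound (aestronglyMeasurable_gradient hgrad hint w) _
    (Filter.Eventually.of_forall (norm_gradient_le_of_smooth hsmooth hb w))

/-- First-order form of strong convexity for an averaged loss. -/
theorem StrongConvexOn.integral_inner_gradient_le
    (hgrad : ∀ z w, HasGradientAt (fun v => f v z) (f' w z) w)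
    (hconv : ∀ z, ConvexOn ℝ Set.univ (fun v => f v z))
    (hint : ∀ w, Integrable (f w) p) (hint' : ∀ w, Integrable (f' w) p)
    (hsc : StrongConvexOn Set.univ μ fun w => ∫ z, f w z ∂p) (w e : W) :
    ∫ z, ⟪f' w z, e⟫ ∂p ≤ ∫ z, f (w + e) z ∂p - ∫ z, f w z ∂p - μ / 2 * ‖e‖ ^ 2 := by
  have hlim : Filter.Tendsto (fun n : ℕ => ∫ z, f (w + e) z ∂p - ∫ z, f w z ∂p
      - (1 - 1 / ((n : ℝ) + 1)) * (μ / 2 * ‖e‖ ^ 2)) Filter.atTop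
      (nhds (∫ z, f (w + e) z ∂p - ∫ z, f w z ∂p - (1 - 0) * (μ / 2 * ‖e‖ ^ 2))) :=
    ((tendsto_one_div_add_atTop_nhds_zero_nat.const_sub 1).mul_const _).const_sub _
  rw [sub_zero, one_mul] at hlim
  refine ge_of_tendsto hlim (Filter.Eventually.of_forall fun n => ?_)
  have ht : 0 < 1 / ((n : ℝ) + 1) := by positivity
  have ht1 : 1 / ((n : ℝ) + 1) ≤ 1 := by
    rw [one_div]; exact inv_le_one_of_one_le₀ (by simp)
  generalize 1 / ((n : ℝ) + 1) = t at ht ht1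
  have key := hsc.2 (Set.mem_univ w) (Set.mem_univ (w + e)) (sub_nonneg.2 ht1) ht.le (by ring)
  rw [show (1 - t) • w + t • (w + e) = w + t • e by module, sub_add_cancel_left, norm_neg] at key
  simp only [smul_eq_mul] at key
  have hlow : ∫ z, ⟪f' w z, t • e⟫ ∂p ≤ ∫ z, (f (w + t • e) z - f w z) ∂p :=
    integral_mono ((hint' w).inner_const _) ((hint _).sub (hint w))
      fun z => (hconv z).inner_gradient_le_s15 (hgrad z w) (t • e)
  rw [integral_sub (hint _) (hint w)] at hlow
  simp only [real_inner_smul_right, integral_const_mul] at hlow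
  refine le_of_mul_le_mul_left ?_ ht
  linarith

/-- Strong monotonicity of the averaged gradient. -/
theorem StrongConvexOn.mul_sq_le_integral_inner
    (hgrad : ∀ z w, HasGradientAt (fun v => f v z) (f' w z) w)
    (hconv : ∀ z, ConvexOn ℝ Set.univ (fun v => f v z))
    (hint : ∀ w, Integrable (f w) p) (hint' : ∀ w, Integrable (f' w) p)
    (hsc : StrongConvexOn Set.univ μ fun w => ∫ z, f w z ∂p) (w w' : W) :
    μ * ‖w - w'‖ ^ 2 ≤ ∫ z, ⟪f' w z - f' w' z, w - w'⟫ ∂p := by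
  have h1 := hsc.integral_inner_gradient_le hgrad hconv hint hint' w (w' - w)
  have h2 := hsc.integral_inner_gradient_le hgrad hconv hint hint' w' (w - w')
  simp only [← neg_sub w w', inner_neg_right, integral_neg, norm_neg] at h1
  rw [neg_sub, add_sub_cancel] at h1
  rw [add_sub_cancel] at h2
  simp only [inner_sub_left (f' w _)]
  rw [integral_sub ((hint' w).inner_const _) ((hint' w').inner_const _)]
  linarith

theorem StrongConvexOn.modulus_le_smoothness [IsProbabilityMeasure p] [Nontrivial W]
    (hgrad : ∀ z w, HasGradientAt (fun v => f v z) (f' w z) w)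
    (hconv : ∀ z, ConvexOn ℝ Set.univ (fun v => f v z))
    (hsmooth : ∀ z w w', ‖f' w z - f' w' z‖ ≤ β * ‖w - w'‖)
    (hint : ∀ w, Integrable (f w) p) (hint' : ∀ w, Integrable (f' w) p)
    (hsc : StrongConvexOn Set.univ μ fun w => ∫ z, f w z ∂p) : μ ≤ β := by
  obtain ⟨w, w', hne⟩ := exists_pair_ne W
  have h1 := hsc.mul_sq_le_integral_inner hgrad hconv hint hint' w w'
  have h2 : ∫ z, ⟪f' w z - f' w' z, w - w'⟫ ∂p ≤ ∫ _, β * ‖w - w'‖ ^ 2 ∂p := by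
    refine integral_mono (((hint' w).sub (hint' w')).inner_const _) (integrable_const _)
      fun z => (real_inner_le_norm _ _).trans ?_
    rw [sq, ← mul_assoc]
    exact mul_le_mul_of_nonneg_right (hsmooth z w w') (norm_nonneg _)
  rw [integral_const, probReal_univ, one_smul] at h2
  exact le_of_mul_le_mul_right (h1.trans h2) (by have := norm_sub_pos_iff.2 hne; positivity)

/-- One SGD step driven by a shared sample contracts in expectation. -/
theorem StrongConvexOn.integral_norm_sgd_step_le [IsProbabilityMeasure p]
    (hgrad : ∀ z w, HasGradientAt (fun v => f v z) (f' w z) w)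
    (hconv : ∀ z, ConvexOn ℝ Set.univ (fun v => f v z))
    (hsmooth : ∀ z w w', ‖f' w z - f' w' z‖ ≤ β * ‖w - w'‖)
    (hint : ∀ w, Integrable (f w) p) (hint' : ∀ w, Integrable (f' w) p)
    (hsc : StrongConvexOn Set.univ μ fun w => ∫ z, f w z ∂p)
    {η : ℝ} (hη0 : 0 ≤ η) (hη : η * β ^ 2 ≤ μ) (hημ : μ * η ≤ 2) (w w' : W) :
    ∫ z, ‖(w - η • f' w z) - (w' - η • f' w' z)‖ ∂p ≤ (1 - μ * η / 2) * ‖w - w'‖ := by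
  set X : Z → ℝ := fun z => ‖(w - η • f' w z) - (w' - η • f' w' z)‖
  have hD : Integrable (fun z => ⟪f' w z - f' w' z, w - w'⟫) p :=
    ((hint' w).sub (hint' w')).inner_const _
  have hXint : Integrable X p :=
    (((integrable_const w).sub ((hint' w).smul η)).sub
      ((integrable_const w').sub ((hint' w').smul η))).norm
  have hsq : ∀ z, X z ^ 2 ≤
      (1 + η ^ 2 * β ^ 2) * ‖w - w'‖ ^ 2 - 2 * η * ⟪f' w z - f' w' z, w - w'⟫ := by
    intro z
    have hg : ‖f' w z - f' w' z‖ ^ 2 ≤ (β * ‖w - w'‖) ^ 2 := by gcongr; exact hsmooth z w w'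
    have he : X z ^ 2 = ‖w - w'‖ ^ 2 - 2 * (η * ⟪f' w z - f' w' z, w - w'⟫)
        + η ^ 2 * ‖f' w z - f' w' z‖ ^ 2 := by
      simp only [X]
      rw [show w - η • f' w z - (w' - η • f' w' z) = (w - w') - η • (f' w z - f' w' z) by module,
        norm_sub_sq_real, real_inner_smul_right, real_inner_comm, norm_smul, mul_pow,
        Real.norm_eq_abs, sq_abs]
    rw [he]
    nlinarith [mul_le_mul_of_nonneg_left hg (sq_nonneg η)]
  set B := (1 - μ * η / 2) * ‖w - w'‖
  have hB : 0 ≤ B := mul_nonneg (by linarith) (norm_nonneg _)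
  have hXsq : Integrable (fun z => X z ^ 2) p :=
    ((integrable_const _).sub (hD.const_mul (2 * η))).mono' (hXint.aestronglyMeasurable.pow 2)
      (Filter.Eventually.of_forall fun z => by
        rw [Real.norm_of_nonneg (sq_nonneg _)]; exact hsq z)
  have hEsq : ∫ z, X z ^ 2 ∂p ≤ B ^ 2 := by
    have h1 := integral_mono hXsq ((integrable_const _).sub (hD.const_mul (2 * η))) hsq
    simp only [Pi.sub_apply] at h1
    rw [integral_sub (integrable_const _) (hD.const_mul (2 * η)), integral_const, probReal_univ,
      one_smul, integral_const_mul] at h1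
    have h2 := hsc.mul_sq_le_integral_inner hgrad hconv hint hint' w w'
    have h3 := mul_le_mul_of_nonneg_left h2 (mul_nonneg two_pos.le hη0)
    have h4 := mul_le_mul_of_nonneg_right (mul_le_mul_of_nonneg_left hη hη0)
      (sq_nonneg ‖w - w'‖)
    simp only [B]
    nlinarith [mul_nonneg (sq_nonneg (μ * η)) (sq_nonneg ‖w - w'‖)]
  have hjensen : (∫ z, X z ∂p) ^ 2 ≤ ∫ z, X z ^ 2 ∂p :=
    (convexOn_pow 2).map_integral_le (continuous_pow 2).continuousOn isClosed_Ici
      (Filter.Eventually.of_forall fun z => norm_nonneg _) hXint hXsq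
  exact (sq_le_sq₀ (integral_nonneg fun z => norm_nonneg _) hB).1 (hjensen.trans hEsq)

end StochasticGradient

/-- coupled SGD step across two distributions: for any step size
`0 < η ≤ 2/(κ²(μ+β))`, models `w, w'`, and independent samples `Z₁ ∼ p₁`, `Z₂ ∼ p₂`,
`E[‖(w − η∇f(w;Z₁)) − (w' − η∇f(w';Z₂))‖] ≤ (1 − μη/2)‖w − w'‖
  + η(√(2β²κ‖w' − w*₁‖² + 2𝒢₁) + √(2β²κ‖w' − w*₂‖² + 2𝒢₂))`. -/
theorem stmt15
    {W : Type*} [NormedAddCommGroup W] [InnerProductSpace ℝ W] [FiniteDimensional ℝ W]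
    {Z : Type*} [MeasurableSpace Z]
    (p₁ p₂ : Measure Z) [IsProbabilityMeasure p₁] [IsProbabilityMeasure p₂]
    (f : W → Z → ℝ) (f' : W → Z → W)
    (β μ : ℝ) (hβ : 0 < β) (hμ : 0 < μ)
    (hgrad : ∀ z w, HasGradientAt (fun v => f v z) (f' w z) w)
    (hconv : ∀ z, ConvexOn ℝ Set.univ (fun v => f v z))
    (hsmooth : ∀ z w w', ‖f' w z - f' w' z‖ ≤ β * ‖w - w'‖)
    (F₁ F₂ : W → ℝ)
    (hF₁ : ∀ w, F₁ w = ∫ z, f w z ∂p₁) (hF₂ : ∀ w, F₂ w = ∫ z, f w z ∂p₂)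
    (hsc₁ : StrongConvexOn Set.univ μ F₁) (hsc₂ : StrongConvexOn Set.univ μ F₂)
    (ws₁ ws₂ : W) (hmin₁ : ∀ w, F₁ ws₁ ≤ F₁ w) (hmin₂ : ∀ w, F₂ ws₂ ≤ F₂ w)
    (𝒢₁ 𝒢₂ : ℝ) (h𝒢₁ : 0 ≤ 𝒢₁) (h𝒢₂ : 0 ≤ 𝒢₂)
    (hb₁ : ∀ z, ‖f' ws₁ z‖ ^ 2 ≤ 𝒢₁) (hb₂ : ∀ z, ‖f' ws₂ z‖ ^ 2 ≤ 𝒢₂)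
    (κ : ℝ) (hκ : κ = β / μ)
    (η : ℝ) (hη0 : 0 < η) (hη : η ≤ 2 / (κ ^ 2 * (μ + β)))
    (w w' : W) :
    ∫ zz : Z × Z, ‖(w - η • f' w zz.1) - (w' - η • f' w' zz.2)‖ ∂(p₁.prod p₂) ≤
      (1 - μ * η / 2) * ‖w - w'‖
        + η * (Real.sqrt (2 * β ^ 2 * κ * ‖w' - ws₁‖ ^ 2 + 2 * 𝒢₁)
            + Real.sqrt (2 * β ^ 2 * κ * ‖w' - ws₂‖ ^ 2 + 2 * 𝒢₂)) := by
  obtain rfl : F₁ = fun w => ∫ z, f w z ∂p₁ := funext hF₁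
  obtain rfl : F₂ = fun w => ∫ z, f w z ∂p₂ := funext hF₂
  rcases subsingleton_or_nontrivial W with hW | hW
  · have h0 : ∀ zz : Z × Z, ‖(w - η • f' w zz.1) - (w' - η • f' w' zz.2)‖ = 0 := fun _ =>
      norm_eq_zero.2 (Subsingleton.elim _ _)
    rw [Subsingleton.elim w w'] at h0 ⊢
    simp only [h0, integral_zero, sub_self, norm_zero, mul_zero, zero_add]
    positivity
  have hint₁ := hsc₁.integrable_loss hμ hβ.le hgrad hconv hsmooth hb₁
  have hint₂ := hsc₂.integrable_loss hμ hβ.le hgrad hconv hsmooth hb₂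
  have hint₁' := integrable_gradient hgrad hsmooth hb₁ hint₁
  have hint₂' := integrable_gradient hgrad hsmooth hb₂ hint₂
  have hle : μ ≤ β := hsc₁.modulus_le_smoothness hgrad hconv hsmooth hint₁ hint₁'
  have hκ1 : 1 ≤ κ := by rw [hκ, one_le_div hμ]; exact hle
  have hηβ : η * β ^ 2 ≤ μ := by
    have hκβ : κ * μ = β := by rw [hκ]; field_simp
    have h1 := (le_div_iff₀ (by positivity)).1 hη
    have h2 : η * β ^ 2 * (μ + β) ≤ μ * (μ + β) := by
      calc η * β ^ 2 * (μ + β) = μ ^ 2 * (η * (κ ^ 2 * (μ + β))) := by rw [← hκβ]; ring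
        _ ≤ μ ^ 2 * 2 := by gcongr
        _ ≤ μ * (μ + β) := by nlinarith
    exact le_of_mul_le_mul_right h2 (by positivity)
  have hημ : μ * η ≤ 2 := by
    have h1 : η * μ ^ 2 ≤ μ := le_trans (by gcongr) hηβ
    nlinarith
  have hstep := hsc₁.integral_norm_sgd_step_le hgrad hconv hsmooth hint₁ hint₁' hη0.le hηβ hημ w w'
  set S := √(2 * β ^ 2 * κ * ‖w' - ws₁‖ ^ 2 + 2 * 𝒢₁) + √(2 * β ^ 2 * κ * ‖w' - ws₂‖ ^ 2 + 2 * 𝒢₂)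
  have hshared : Integrable (fun z => ‖(w - η • f' w z) - (w' - η • f' w' z)‖) p₁ :=
    (((integrable_const w).sub ((hint₁' w).smul η)).sub
      ((integrable_const w').sub ((hint₁' w').smul η))).norm
  have hlhs : Integrable
      (fun zz : Z × Z => ‖(w - η • f' w zz.1) - (w' - η • f' w' zz.2)‖) (p₁.prod p₂) :=
    (((integrable_const w).sub (((hint₁' w).comp_fst p₂).smul η)).sub
      ((integrable_const w').sub (((hint₂' w').comp_snd p₁).smul η))).norm
  have hpt : ∀ zz : Z × Z, ‖(w - η • f' w zz.1) - (w' - η • f' w' zz.2)‖ ≤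
      ‖(w - η • f' w zz.1) - (w' - η • f' w' zz.1)‖ + η * S := by
    rintro ⟨z₁, z₂⟩
    have h1 := norm_gradient_le_sqrt_of_smooth hsmooth hb₁ hκ1 w' z₁
    have h2 := norm_gradient_le_sqrt_of_smooth hsmooth hb₂ hκ1 w' z₂
    have h3 : ‖η • (f' w' z₂ - f' w' z₁)‖ ≤ η * S := by
      rw [norm_smul, Real.norm_of_nonneg hη0.le]
      gcongr
      linarith [norm_sub_le (f' w' z₂) (f' w' z₁)]
    calc ‖(w - η • f' w z₁) - (w' - η • f' w' z₂)‖
        = ‖((w - η • f' w z₁) - (w' - η • f' w' z₁)) + η • (f' w' z₂ - f' w' z₁)‖ := by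
          congr 1; module
      _ ≤ _ := (norm_add_le _ _).trans (by gcongr)
  have hmono := integral_mono hlhs ((hshared.comp_fst p₂).add (integrable_const (η * S))) hpt
  simp only [Pi.add_apply] at hmono
  rw [integral_add (hshared.comp_fst p₂) (integrable_const _), integral_const, probReal_univ,
    one_smul, integral_fun_fst (fun z => ‖(w - η • f' w z) - (w' - η • f' w' z)‖),
    probReal_univ, one_smul] at hmono
  linarith
end
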